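/- arXiv:2505.08025 — 5 statements merged into one kernel-verified Lean document; each statement's English description precedes it below -/
import Mathlib

section
/- Let p be a plan that completes the task (s, g) by time T. Let Cᵥ be a finite set of vertex constraints, i.e. pairs (v, t) ∈ V × ℕ with v ≠ s, let Cₑ be a finite set of edge constraints, i.e. triples (u, v, t) ∈ V × V × ℕ with u ≠ v, and let T₀ be an upper bound on the times t of all constraints in Cᵥ and Cₑ. Define the delayed plan p' by p' t = s if t ≤ T₀ and p' t = p (t − T₀ − 1) otherwise. Then p' is a plan that completes the task (s, g) by time T + T₀ + 1; for every (v, t) ∈ Cᵥ one has p' t ≠ v; and for every (u, v, t) ∈ Cₑ it is not the case that p' t = u and p' (t+1) = v. In particular, the delay incurred by waiting out all bounded constraints is at most T₀ + 1. -/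
/-- A plan on a simple graph `G`: at each timestep the agent waits or moves along an edge. -/
def IsPlan {V : Type*} (G : SimpleGraph V) (p : ℕ → V) : Prop :=
  ∀ t, p (t + 1) = p t ∨ G.Adj (p t) (p (t + 1))

/-- `p` completes the task `(s, g)` by time `T`. -/
def Completes {V : Type*} (p : ℕ → V) (s g : V) (T : ℕ) : Prop :=
  p 0 = s ∧ ∀ t, T ≤ t → p t = g

theorem delayed_apply_of_le {V : Type*} {p : ℕ → V} {s : V} (h0 : p 0 = s) {T₀ t : ℕ}
    (ht : t ≤ T₀ + 1) : (if t ≤ T₀ then s else p (t - T₀ - 1)) = s := by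
  split_ifs with h
  · rfl
  · rw [show t - T₀ - 1 = 0 by omega, h0]

theorem delayed_apply_of_lt {V : Type*} (p : ℕ → V) (s : V) {T₀ t : ℕ} (ht : T₀ < t) :
    (if t ≤ T₀ then s else p (t - T₀ - 1)) = p (t - T₀ - 1) :=
  if_neg (by omega)

theorem delayed_plan_satisfies_bounded_constraints {V : Type*} (G : SimpleGraph V)
    (p : ℕ → V) (s g : V) (T : ℕ)
    (Cv : Finset (V × ℕ)) (Ce : Finset (V × V × ℕ)) (T₀ : ℕ)
    (hp : IsPlan G p) (hpc : Completes p s g T)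
    (hCv : ∀ c ∈ Cv, c.1 ≠ s)
    (hCe : ∀ c ∈ Ce, c.1 ≠ c.2.1)
    (hCvT : ∀ c ∈ Cv, c.2 ≤ T₀)
    (hCeT : ∀ c ∈ Ce, c.2.2 ≤ T₀) :
    IsPlan G (fun t => if t ≤ T₀ then s else p (t - T₀ - 1)) ∧
    Completes (fun t => if t ≤ T₀ then s else p (t - T₀ - 1)) s g (T + T₀ + 1) ∧
    (∀ c ∈ Cv, (fun t => if t ≤ T₀ then s else p (t - T₀ - 1)) c.2 ≠ c.1) ∧
    (∀ c ∈ Ce, ¬ ((fun t => if t ≤ T₀ then s else p (t - T₀ - 1)) c.2.2 = c.1 ∧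
      (fun t => if t ≤ T₀ then s else p (t - T₀ - 1)) (c.2.2 + 1) = c.2.1)) := by
  obtain ⟨h0, hT⟩ := hpc
  refine ⟨fun t => ?_, ⟨if_pos (Nat.zero_le _), fun t ht => ?_⟩, fun c hc h => ?_, ?_⟩
  · dsimp only
    rcases Nat.lt_or_ge T₀ t with h | h
    · rw [delayed_apply_of_lt p s h, delayed_apply_of_lt p s (show T₀ < t + 1 by omega),
        show t + 1 - T₀ - 1 = t - T₀ - 1 + 1 by omega]
      exact hp _
    · left
      rw [delayed_apply_of_le h0 (show t + 1 ≤ T₀ + 1 by omega), if_pos h]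
  · dsimp only
    rw [delayed_apply_of_lt p s (by omega)]
    exact hT _ (by omega)
  · dsimp only at h
    rw [if_pos (hCvT c hc)] at h
    exact hCv c hc h.symm
  · rintro c hc ⟨hu, hv⟩
    have ht := hCeT c hc
    dsimp only at hu hv
    rw [if_pos ht] at hu
    rw [delayed_apply_of_le h0 (by omega)] at hv
    exact hCe c hc (hu.symm.trans hv)
end

section
/- Let q be a plan and T_q a time with q t = g_q for all t ≥ T_q (a virtual agent that eventually comes to rest at g_q). Suppose q t ≠ s for every t, that s ≠ g_q and g ≠ g_q, and that s and g are joined by a walk in the subgraph of G induced on V \ {g_q}. Then there exist a plan p and a time T such that p completes the task (s, g) by time T and the pair of plans (p, q) has no vertex conflict and no edge conflict at any time. (One-way constraint influence: the network agent can always replan around a fixed virtual agent that eventually rests, without altering the virtual agent's path.) -/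
/-- Two plans have a vertex conflict at time `t` if they occupy the same vertex. -/
def PairVertexConflict {V : Type*} (p q : ℕ → V) (t : ℕ) : Prop := p t = q t

/-- Two plans have an edge conflict at time `t` if they swap positions along an edge. -/
def PairEdgeConflict {V : Type*} (p q : ℕ → V) (t : ℕ) : Prop :=
  p (t + 1) = q t ∧ q (t + 1) = p t ∧ p t ≠ p (t + 1)

/-- Follow a walk, one edge per timestep, starting at time `T`. -/
def SimpleGraph.Walk.delayedPlan {V : Type*} {G : SimpleGraph V} {S : Set V} {u v : S}
    (w : (G.induce S).Walk u v) (T t : ℕ) : V :=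
  w.getVert (t - T)

theorem SimpleGraph.Walk.isPlan_delayedPlan {V : Type*} {G : SimpleGraph V} {S : Set V} {u v : S}
    (w : (G.induce S).Walk u v) (T : ℕ) : IsPlan G (w.delayedPlan T) := by
  intro t
  unfold delayedPlan
  rcases lt_or_ge t T with ht | ht
  · left
    rw [show t + 1 - T = 0 by omega, show t - T = 0 by omega]
  · rw [show t + 1 - T = t - T + 1 by omega]
    rcases lt_or_ge (t - T) w.length with hl | hl
    · exact Or.inr (w.adj_getVert_succ hl)
    · left
      rw [w.getVert_of_length_le hl, w.getVert_of_length_le (by omega)]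

theorem SimpleGraph.Walk.delayedPlan_of_le {V : Type*} {G : SimpleGraph V} {S : Set V} {u v : S}
    (w : (G.induce S).Walk u v) {T t : ℕ} (h : t ≤ T) : w.delayedPlan T t = u := by
  simp [delayedPlan, Nat.sub_eq_zero_of_le h]

theorem SimpleGraph.Walk.completes_delayedPlan {V : Type*} {G : SimpleGraph V} {S : Set V}
    {u v : S} (w : (G.induce S).Walk u v) (T : ℕ) :
    Completes (w.delayedPlan T) u v (T + w.length) := by
  refine ⟨w.delayedPlan_of_le (Nat.zero_le T), fun t ht => ?_⟩
  rw [delayedPlan, w.getVert_of_length_le (by omega)]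

theorem replan_around_virtual_agent {V : Type*} (G : SimpleGraph V)
    (q : ℕ → V) (Tq : ℕ) (s g gq : V)
    (hq : IsPlan G q) (hqrest : ∀ t, Tq ≤ t → q t = gq)
    (hqs : ∀ t, q t ≠ s) (hsgq : s ≠ gq) (hggq : g ≠ gq)
    (hreach : (G.induce {v : V | v ≠ gq}).Reachable ⟨s, hsgq⟩ ⟨g, hggq⟩) :
    ∃ (p : ℕ → V) (T : ℕ), IsPlan G p ∧ Completes p s g T ∧
      ∀ t, ¬ PairVertexConflict p q t ∧ ¬ PairEdgeConflict p q t := by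
  obtain ⟨w⟩ := hreach
  have hne : ∀ t, w.delayedPlan Tq t ≠ gq := fun t => (w.getVert (t - Tq)).2
  refine ⟨w.delayedPlan Tq, Tq + w.length, w.isPlan_delayedPlan Tq,
    w.completes_delayedPlan Tq, fun t => ⟨fun h => ?_, fun ⟨h, _, hmove⟩ => ?_⟩⟩
  · rcases le_total t Tq with ht | ht
    · exact hqs t (h.symm.trans (w.delayedPlan_of_le ht))
    · exact hne t (h.trans (hqrest t ht))
  · rcases lt_or_ge t Tq with ht | ht
    · exact hmove ((w.delayedPlan_of_le ht.le).trans (w.delayedPlan_of_le ht).symm)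
    · exact hne (t + 1) (h.trans (hqrest t ht))
end

section
/- Let n agents, indexed by Fin n, have tasks (s i, g i) such that the starts s i are pairwise distinct, the goals g i are pairwise distinct, and s i ≠ g j whenever i ≠ j. Suppose that for every i, the vertices s i and g i are joined by a walk in the subgraph of G induced on the complement of the endpoint set {s j : j ≠ i} ∪ {g j : j ≠ i}. Then there exist a conflict-free team plan (p i) and a time T such that for every i, the plan p i completes the task (s i, g i) by time T. (Well-formed instances—where each agent has a path between its endpoints avoiding all other agents' endpoints—are solvable by scheduling the agents sequentially.) -/
/-- The team plan `p` has a vertex conflict at time `t`. -/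
def VertexConflict {V ι : Type*} (p : ι → ℕ → V) (t : ℕ) : Prop :=
  ∃ i j, i ≠ j ∧ p i t = p j t

/-- The team plan `p` has an edge conflict at time `t`. -/
def EdgeConflict {V ι : Type*} (p : ι → ℕ → V) (t : ℕ) : Prop :=
  ∃ i j, i ≠ j ∧ p i (t + 1) = p j t ∧ p j (t + 1) = p i t ∧ p i t ≠ p i (t + 1)

/-- A team plan is conflict-free if it has no vertex conflict and no edge conflict at any time. -/
def ConflictFree {V ι : Type*} (p : ι → ℕ → V) : Prop :=
  ∀ t, ¬ VertexConflict p t ∧ ¬ EdgeConflict p t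

/-- The set of endpoints of all agents other than `i`. -/
def OtherEndpoints {V : Type*} {n : ℕ} (s g : Fin n → V) (i : Fin n) : Set V :=
  {v | ∃ j, j ≠ i ∧ (v = s j ∨ v = g j)}

/-- A walk in an induced subgraph gives a plan that stays in the inducing set. -/
lemma SimpleGraph.Reachable.exists_isPlan {V : Type*} {G : SimpleGraph V} {S : Set V} {a b : S}
    (h : (G.induce S).Reachable a b) :
    ∃ (q : ℕ → V) (L : ℕ), IsPlan G q ∧ Completes q a b L ∧ ∀ t, q t ∈ S := by
  obtain ⟨w⟩ := h
  refine ⟨fun t => w.getVert t, w.length, fun t => ?_, ⟨by simp, fun t ht => ?_⟩,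
    fun t => (w.getVert t).2⟩
  · rcases lt_or_ge t w.length with ht | ht
    · exact .inr (w.adj_getVert_succ ht)
    · left
      simp only [w.getVert_of_length_le ht, w.getVert_of_length_le (ht.trans t.le_succ)]
  · simp only [w.getVert_of_length_le ht]

/-- Delaying the start of a plan by `d` steps gives a plan. -/
lemma IsPlan.delay {V : Type*} {G : SimpleGraph V} {q : ℕ → V} (hq : IsPlan G q) (d : ℕ) :
    IsPlan G fun t => q (t - d) := by
  intro t
  rcases lt_or_ge t d with h | h
  · left
    simp only [Nat.sub_eq_zero_of_le h, Nat.sub_eq_zero_of_le h.le]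
  · simpa only [Nat.sub_add_comm h] using hq (t - d)

/-- A team plan is conflict-free if, of any two agents, at each time either the later one is
still at a vertex the earlier one never visits, or the earlier one is already at a vertex the
later one never visits. -/
lemma conflictFree_of_forall_lt {V ι : Type*} [LinearOrder ι] {p : ι → ℕ → V}
    (h : ∀ i j, i < j → ∀ t, (∀ t', p i t' ≠ p j t) ∨ ∀ t', p j t' ≠ p i t) :
    ConflictFree p := by
  refine fun t => ⟨?_, ?_⟩
  · rintro ⟨i, j, hij, he⟩
    rcases hij.lt_or_gt with hlt | hlt
    · exact (h i j hlt t).elim (fun H => H t he) (fun H => H t he.symm)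
    · exact (h j i hlt t).elim (fun H => H t he.symm) (fun H => H t he)
  · rintro ⟨i, j, hij, he, he', -⟩
    rcases hij.lt_or_gt with hlt | hlt
    · exact (h i j hlt t).elim (fun H => H _ he) (fun H => H _ he')
    · exact (h j i hlt t).elim (fun H => H _ he') (fun H => H _ he)

theorem well_formed_instances_solvable {V : Type*} (G : SimpleGraph V) (n : ℕ)
    (s g : Fin n → V)
    (hs : Function.Injective s) (hg : Function.Injective g)
    (hsg : ∀ i j, i ≠ j → s i ≠ g j)
    (hreach : ∀ i, ∃ (hsi : s i ∈ (OtherEndpoints s g i)ᶜ) (hgi : g i ∈ (OtherEndpoints s g i)ᶜ),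
      (G.induce ((OtherEndpoints s g i)ᶜ)).Reachable ⟨s i, hsi⟩ ⟨g i, hgi⟩) :
    ∃ (p : Fin n → ℕ → V) (T : ℕ), (∀ i, IsPlan G (p i)) ∧ ConflictFree p ∧
      ∀ i, Completes (p i) (s i) (g i) T := by
  choose hsi hgi hr using hreach
  choose q L hplan hcomp havoid using fun i => (hr i).exists_isPlan
  let M := Finset.univ.sup L
  have hM (i : Fin n) (t : ℕ) (ht : (i + 1) * M ≤ t) : q i (t - i * M) = g i := by
    have hL : L i ≤ M := Finset.le_sup (Finset.mem_univ i)
    exact (hcomp i).2 _ (hL.trans (Nat.le_sub_of_add_le (by linarith)))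
  refine ⟨fun i t => q i (t - i * M), n * M, fun i => (hplan i).delay _,
    conflictFree_of_forall_lt fun i j hij t => ?_, fun i => ⟨?_, fun t ht => ?_⟩⟩
  · rcases le_total t (j * M) with h | h
    · left
      intro t' he
      rw [Nat.sub_eq_zero_of_le h, (hcomp j).1] at he
      exact havoid i _ ⟨j, hij.ne', .inl he⟩
    · right
      intro t' he
      rw [hM i t ((Nat.mul_le_mul_right M (Nat.succ_le_of_lt hij)).trans h)] at he
      exact havoid j _ ⟨i, hij.ne, .inr he⟩
  · simpa using (hcomp i).1
  · exact hM i t ((Nat.mul_le_mul_right M i.2).trans ht)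
end

section
/- Let (p i)_{i ∈ ι} be a conflict-free team plan and let t₁ < t₂ be times with p i t₁ = p i t₂ for every agent i (the joint configuration repeats). Define the spliced family q i t = p i t for t ≤ t₁ and q i t = p i (t + (t₂ − t₁)) for t > t₁. Then each q i is a plan, the team plan (q i) is conflict-free, and if p i completes the task (s i, g i) by time T then q i completes the task (s i, g i) by time T. -/
/-- Each step of the spliced family is, for all agents simultaneously, a step of the original family
at a time that is no earlier. -/
theorem exists_step_eq_of_splice {V ι : Type*} (p : ι → ℕ → V) {t₁ t₂ : ℕ}
    (ht : t₁ < t₂) (hrep : ∀ i, p i t₁ = p i t₂) (t : ℕ) :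
    ∃ u, t ≤ u ∧ ∀ i,
      (if t ≤ t₁ then p i t else p i (t + (t₂ - t₁))) = p i u ∧
      (if t + 1 ≤ t₁ then p i (t + 1) else p i (t + 1 + (t₂ - t₁))) = p i (u + 1) := by
  rcases lt_trichotomy t t₁ with h | rfl | h
  · exact ⟨t, le_rfl, fun i => ⟨if_pos h.le, if_pos h⟩⟩
  · refine ⟨t₂, ht.le, fun i => ⟨by rw [if_pos le_rfl, hrep], ?_⟩⟩
    rw [if_neg (by omega)]
    congr 1
    omega
  · refine ⟨t + (t₂ - t₁), by omega, fun i => ⟨if_neg (by omega), ?_⟩⟩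
    rw [if_neg (by omega)]
    congr 1
    omega

theorem spliced_team_plan {V ι : Type*} [Fintype ι] (G : SimpleGraph V)
    (p : ι → ℕ → V) (t₁ t₂ : ℕ)
    (hp : ∀ i, IsPlan G (p i)) (hcf : ConflictFree p)
    (ht : t₁ < t₂) (hrep : ∀ i, p i t₁ = p i t₂) :
    (∀ i, IsPlan G (fun t => if t ≤ t₁ then p i t else p i (t + (t₂ - t₁)))) ∧
    ConflictFree (fun i t => if t ≤ t₁ then p i t else p i (t + (t₂ - t₁))) ∧
    ∀ i (s g : V) (T : ℕ), Completes (p i) s g T →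
      Completes (fun t => if t ≤ t₁ then p i t else p i (t + (t₂ - t₁))) s g T := by
  have step := exists_step_eq_of_splice p ht hrep
  refine ⟨fun i t => ?_, fun t => ?_, fun i s g T h => ⟨?_, fun t hT => ?_⟩⟩
  · obtain ⟨u, -, hu⟩ := step t
    simp only [(hu i).1, (hu i).2]
    exact hp i u
  · obtain ⟨u, -, hu⟩ := step t
    refine ⟨?_, ?_⟩
    · rintro ⟨i, j, hij, h⟩
      simp only [(hu _).1] at h
      exact (hcf u).1 ⟨i, j, hij, h⟩
    · rintro ⟨i, j, hij, h⟩
      simp only [(hu _).1, (hu _).2] at h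
      exact (hcf u).2 ⟨i, j, hij, h⟩
  · simpa using h.1
  · obtain ⟨u, htu, hu⟩ := step t
    exact (hu i).1.trans (h.2 u (hT.trans htu))
end

section
/- Assume V is a finite type and the agents are indexed by Fin n. If there exists a conflict-free team plan in which every agent i completes the task (s i, g i) by some time, then there exists a conflict-free team plan in which every agent i completes the task (s i, g i) by time (Fintype.card V)^n. In particular, whenever a valid collision-free plan exists, one of bounded makespan exists. -/
/-- A trajectory of a relation on a finite type that settles at `b` can be shortened, by cutting
out cycles, to one that settles within as many steps as there are states. -/
theorem exists_trajectory_settling_by_card {S : Type*} [Fintype S] (R : S → S → Prop) (a b : S)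
    (T : ℕ) (f : ℕ → S) (hR : ∀ t, R (f t) (f (t + 1))) (h0 : f 0 = a)
    (hT : ∀ t, T ≤ t → f t = b) :
    ∃ f' : ℕ → S, (∀ t, R (f' t) (f' (t + 1))) ∧ f' 0 = a ∧
      ∀ t, Fintype.card S ≤ t → f' t = b := by
  induction T using Nat.strong_induction_on generalizing f with
  | _ T ih =>
    by_cases hc : T ≤ Fintype.card S
    · exact ⟨f, hR, h0, fun t ht => hT t (hc.trans ht)⟩
    obtain ⟨i, j, hij, hjT, hf⟩ : ∃ i j, i < j ∧ j < T ∧ f i = f j := by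
      obtain ⟨x, y, hne, hxy⟩ := Fintype.exists_ne_map_eq_of_card_lt
        (fun x : Fin T => f x) (by simpa using hc)
      rcases lt_or_gt_of_ne hne with h | h
      · exact ⟨x, y, h, y.2, hxy⟩
      · exact ⟨y, x, h, x.2, hxy.symm⟩
    refine ih (T - (j - i)) (by omega) (fun t => if t < i then f t else f (t + (j - i)))
      (fun t => ?_) ?_ (fun t ht => ?_)
    · rcases lt_trichotomy (t + 1) i with h | h | h
      · simpa [h, show t < i by omega] using hR t
      · have e : t + 1 + (j - i) = j := by omega
        simpa [h, show t < i by omega, e, ← hf, show i + (j - i) = j by omega] using hR t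
      · have e : t + 1 + (j - i) = t + (j - i) + 1 := by omega
        simpa [show ¬ t + 1 < i by omega, show ¬ t < i by omega, e] using hR (t + (j - i))
    · rcases Nat.eq_zero_or_pos i with rfl | h
      · simpa [← hf] using h0
      · simpa [h] using h0
    · simpa [show ¬ t < i by omega] using hT (t + (j - i)) (by omega)

theorem bounded_makespan_solution_exists {V : Type*} [Fintype V] (G : SimpleGraph V)
    (n : ℕ) (s g : Fin n → V)
    (hsol : ∃ p : Fin n → ℕ → V, (∀ i, IsPlan G (p i)) ∧ ConflictFree p ∧
      ∀ i, ∃ T, Completes (p i) (s i) (g i) T) :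
    ∃ p : Fin n → ℕ → V, (∀ i, IsPlan G (p i)) ∧ ConflictFree p ∧
      ∀ i, Completes (p i) (s i) (g i) ((Fintype.card V) ^ n) := by
  obtain ⟨p, hp, hc, hT⟩ := hsol
  choose T hT using hT
  let R : (Fin n → V) → (Fin n → V) → Prop := fun c d =>
    (∀ i, d i = c i ∨ G.Adj (c i) (d i)) ∧ (¬ ∃ i j, i ≠ j ∧ c i = c j) ∧
      ¬ ∃ i j, i ≠ j ∧ d i = c j ∧ d j = c i ∧ c i ≠ d i
  obtain ⟨f, hR, h0, hf⟩ := exists_trajectory_settling_by_card R s g (Finset.univ.sup T)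
    (fun t i => p i t) (fun t => ⟨fun i => hp i t, hc t⟩) (funext fun i => (hT i).1)
    (fun t ht => funext fun i => (hT i).2 t ((Finset.le_sup (Finset.mem_univ i)).trans ht))
  refine ⟨fun i t => f t i, fun i t => (hR t).1 i, fun t => (hR t).2,
    fun i => ⟨congrFun h0 i, fun t ht => congrFun (hf t ?_) i⟩⟩
  simpa using ht
end
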